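/- Let η be the Minkowski bilinear form on ℝ⁴, η(p, q) = p₀q₀ − p₁q₁ − p₂q₂ − p₃q₃, and let ℓ = (1, 1, 0, 0) (a nonzero lightlike vector: η(ℓ, ℓ) = 0). The set of linear equivalences T : ℝ⁴ → ℝ⁴ satisfying η(Tv, Tu) = η(v, u) for all v, u, det T = 1, and T ℓ = ℓ forms a subgroup of the group of linear automorphisms of ℝ⁴, and this subgroup is isomorphic as a group to the Euclidean group E(2) = ℝ² ⋊ SO(2), the semidirect product of ℝ² by the rotation group SO(2) acting on ℝ² by rotations. -/

import Mathlib

/-- The Minkowski bilinear form on `ℝ⁴`. -/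
def minkowski (p q : Fin 4 → ℝ) : ℝ :=
  p 0 * q 0 - p 1 * q 1 - p 2 * q 2 - p 3 * q 3

/-- The matrix of the Lorentz transformation fixing `(1,1,0,0)` with translation part `a` and
rotation part `R`. -/
noncomputable def littleMatrix (a : Fin 2 → ℝ) (R : Matrix (Fin 2) (Fin 2) ℝ) :
    Matrix (Fin 4) (Fin 4) ℝ :=
  !![1 + (a 0 ^ 2 + a 1 ^ 2) / 2, -((a 0 ^ 2 + a 1 ^ 2) / 2),
      a 0 * R 0 0 + a 1 * R 1 0, a 0 * R 0 1 + a 1 * R 1 1;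
    (a 0 ^ 2 + a 1 ^ 2) / 2, 1 - (a 0 ^ 2 + a 1 ^ 2) / 2,
      a 0 * R 0 0 + a 1 * R 1 0, a 0 * R 0 1 + a 1 * R 1 1;
    a 0, -a 0, R 0 0, R 0 1;
    a 1, -a 1, R 1 0, R 1 1]

lemma det_littleMatrix (a : Fin 2 → ℝ) (R : Matrix (Fin 2) (Fin 2) ℝ) :
    (littleMatrix a R).det = R.det := by
  rw [Matrix.det_fin_two]
  simp [littleMatrix, Matrix.det_succ_row_zero, Fin.sum_univ_succ, Fin.succAbove]
  ring

lemma mem_specialOrthogonalGroup_fin_two_iff (R : Matrix (Fin 2) (Fin 2) ℝ) :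
    R ∈ Matrix.specialOrthogonalGroup (Fin 2) ℝ ↔
      R 1 1 = R 0 0 ∧ R 0 1 = -R 1 0 ∧ R 0 0 ^ 2 + R 1 0 ^ 2 = 1 := by
  rw [Matrix.mem_specialOrthogonalGroup_iff, Matrix.mem_orthogonalGroup_iff', Matrix.det_fin_two,
    ← Matrix.ext_iff]
  simp only [Fin.forall_fin_two, Matrix.mul_apply, Fin.sum_univ_two, Matrix.transpose_apply,
    Matrix.one_apply]
  simp only [Fin.isValue, if_true, zero_ne_one, one_ne_zero, if_false]
  constructor
  · rintro ⟨⟨⟨h1, h2⟩, h3, h4⟩, h5⟩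
    refine ⟨?_, ?_, ?_⟩
    · linear_combination (R 0 0) * h5 - (R 1 1) * h1 + R 1 0 * h2
    · linear_combination -(R 0 1) * h1 + (R 0 0) * h2 - R 1 0 * h5
    · linear_combination h1
  · rintro ⟨h1, h2, h3⟩
    rw [h1, h2]
    refine ⟨⟨⟨?_, ?_⟩, ?_, ?_⟩, ?_⟩ <;> linarith

lemma littleMatrix_mul (a a' : Fin 2 → ℝ) {R : Matrix (Fin 2) (Fin 2) ℝ}
    (hR : R ∈ Matrix.specialOrthogonalGroup (Fin 2) ℝ) (R' : Matrix (Fin 2) (Fin 2) ℝ) :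
    littleMatrix a R * littleMatrix a' R' = littleMatrix (a + R.mulVec a') (R * R') := by
  obtain ⟨h1, h2, h3⟩ := (mem_specialOrthogonalGroup_fin_two_iff R).1 hR
  ext i j
  fin_cases i <;> fin_cases j <;>
    simp [littleMatrix, Matrix.mul_apply, Fin.sum_univ_succ, h1, h2]
  · linear_combination (-(a' 0 ^ 2 + a' 1 ^ 2) / 2) * h3
  · linear_combination ((a' 0 ^ 2 + a' 1 ^ 2) / 2) * h3
  · linear_combination (-(a' 0 * R' 0 0 + a' 1 * R' 1 0)) * h3
  · linear_combination (-(a' 0 * R' 0 1 + a' 1 * R' 1 1)) * h3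
  · linear_combination (-(a' 0 ^ 2 + a' 1 ^ 2) / 2) * h3
  · linear_combination ((a' 0 ^ 2 + a' 1 ^ 2) / 2) * h3
  · linear_combination (-(a' 0 * R' 0 0 + a' 1 * R' 1 0)) * h3
  · linear_combination (-(a' 0 * R' 0 1 + a' 1 * R' 1 1)) * h3
  all_goals ring

lemma minkowski_littleMatrix_mulVec (a : Fin 2 → ℝ) {R : Matrix (Fin 2) (Fin 2) ℝ}
    (hR : R ∈ Matrix.specialOrthogonalGroup (Fin 2) ℝ) (v u : Fin 4 → ℝ) :
    minkowski ((littleMatrix a R).mulVec v) ((littleMatrix a R).mulVec u) = minkowski v u := by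
  obtain ⟨h1, h2, h3⟩ := (mem_specialOrthogonalGroup_fin_two_iff R).1 hR
  simp [minkowski, littleMatrix, Matrix.mulVec, dotProduct, Fin.sum_univ_four, h1, h2]
  linear_combination (-v 2 * u 2 - v 3 * u 3) * h3

lemma littleMatrix_mulVec_lightlike (a : Fin 2 → ℝ) (R : Matrix (Fin 2) (Fin 2) ℝ) :
    (littleMatrix a R).mulVec ![1, 1, 0, 0] = ![1, 1, 0, 0] := by
  ext i
  fin_cases i <;> simp [littleMatrix, Matrix.mulVec, dotProduct, Fin.sum_univ_four]

lemma littleMatrix_inj {a a' : Fin 2 → ℝ} {R R' : Matrix (Fin 2) (Fin 2) ℝ}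
    (h : littleMatrix a R = littleMatrix a' R') : a = a' ∧ R = R' := by
  have key := fun i j => congrFun (congrFun h i) j
  constructor
  · ext i
    fin_cases i
    · exact key 2 0
    · exact key 3 0
  · ext i j
    fin_cases i <;> fin_cases j
    · exact key 2 2
    · exact key 2 3
    · exact key 3 2
    · exact key 3 3

lemma exists_eq_littleMatrix {M : Matrix (Fin 4) (Fin 4) ℝ}
    (hη : ∀ v u, minkowski (M.mulVec v) (M.mulVec u) = minkowski v u) (hdet : M.det = 1)
    (hl : M.mulVec ![1, 1, 0, 0] = ![1, 1, 0, 0]) :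
    ∃ a, ∃ R ∈ Matrix.specialOrthogonalGroup (Fin 2) ℝ, M = littleMatrix a R := by
  have hl' := fun i => congrFun hl i
  have hb := fun i j => hη (Pi.single (M := fun _ => ℝ) i 1) (Pi.single (M := fun _ => ℝ) j 1)
  have hlη := fun j => hη ![1, 1, 0, 0] (Pi.single (M := fun _ => ℝ) j 1)
  simp only [hl] at hlη
  simp only [Matrix.mulVec_single_one, minkowski, Matrix.col_apply] at hb hlη
  have l0 := hl' 0
  have l1 := hl' 1
  have l2 := hl' 2
  have l3 := hl' 3
  simp [Matrix.mulVec, dotProduct, Fin.sum_univ_four] at l0 l1 l2 l3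
  have c0 := hlη 0
  have c2 := hlη 2
  have c3 := hlη 3
  have b00 := hb 0 0
  have b02 := hb 0 2
  have b03 := hb 0 3
  have b22 := hb 2 2
  have b23 := hb 2 3
  have b33 := hb 3 3
  simp at c0 c2 c3 b00 b02 b03 b22 b23 b33
  have e00 : M 0 0 = 1 + (M 2 0 ^ 2 + M 3 0 ^ 2) / 2 := by
    have : M 1 0 = M 0 0 - 1 := by linarith
    rw [this] at b00
    linarith
  have e02 : M 0 2 = M 2 0 * M 2 2 + M 3 0 * M 3 2 := by
    linear_combination b02 - M 0 2 * c0 - M 1 0 * c2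
  have e03 : M 0 3 = M 2 0 * M 2 3 + M 3 0 * M 3 3 := by
    linear_combination b03 - M 0 3 * c0 - M 1 0 * c3
  have hM : M = littleMatrix ![M 2 0, M 3 0] !![M 2 2, M 2 3; M 3 2, M 3 3] := by
    ext i j
    fin_cases i <;> fin_cases j <;> simp [littleMatrix] <;> linarith
  refine ⟨_, _, ?_, hM⟩
  rw [Matrix.mem_specialOrthogonalGroup_iff, Matrix.mem_orthogonalGroup_iff']
  refine ⟨?_, ?_⟩
  · ext i j
    fin_cases i <;> fin_cases j <;> simp [Matrix.mul_apply, Fin.sum_univ_two]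
    · linear_combination -b22 + (M 0 2 + M 1 2) * c2
    · linear_combination -b23 + M 0 3 * c2 + M 1 2 * c3
    · linear_combination -b23 + M 0 3 * c2 + M 1 2 * c3
    · linear_combination -b33 + (M 0 3 + M 1 3) * c3
  · rw [← det_littleMatrix, ← hM, hdet]

/-- The subgroup of linear automorphisms of `ℝ⁴` that preserve the Minkowski form, have
determinant one and fix `(1,1,0,0)`. -/
def littleGroup : Subgroup ((Fin 4 → ℝ) ≃ₗ[ℝ] (Fin 4 → ℝ)) where
  carrier := {T | (∀ v u : Fin 4 → ℝ, minkowski (T v) (T u) = minkowski v u) ∧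
    LinearMap.det (T : (Fin 4 → ℝ) →ₗ[ℝ] (Fin 4 → ℝ)) = 1 ∧ T ![1, 1, 0, 0] = ![1, 1, 0, 0]}
  one_mem' := ⟨fun _ _ => rfl, LinearMap.det_id, rfl⟩
  mul_mem' := by
    rintro S T ⟨hS, dS, lS⟩ ⟨hT, dT, lT⟩
    refine ⟨fun v u => (hS _ _).trans (hT _ _), ?_, ?_⟩
    · exact (LinearMap.det_comp _ _).trans (by rw [dS, dT, one_mul])
    · rw [LinearEquiv.mul_apply, lT, lS]
  inv_mem' := by
    rintro T ⟨hT, dT, lT⟩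
    refine ⟨fun v u => ?_, ?_, ?_⟩
    · rw [← hT]
      exact congrArg₂ minkowski (T.apply_symm_apply v) (T.apply_symm_apply u)
    · have := LinearEquiv.det_symm_mul_det T
      rwa [dT, mul_one] at this
    · exact T.symm_apply_eq.2 lT.symm

/-- The element of the little group with translation part `p.1` and rotation part `p.2`. -/
noncomputable def littleGroupOfEuclidean
    (p : (Fin 2 → ℝ) × Matrix.specialOrthogonalGroup (Fin 2) ℝ) : littleGroup :=
  have hdet : LinearMap.det (Matrix.toLin' (littleMatrix p.1 p.2)) = 1 := by
    rw [LinearMap.det_toLin', det_littleMatrix]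
    exact (Matrix.mem_specialOrthogonalGroup_iff.1 p.2.2).2
  ⟨LinearMap.equivOfDetNeZero (Matrix.toLin' (littleMatrix p.1 p.2)) (hdet ▸ one_ne_zero),
    minkowski_littleMatrix_mulVec p.1 p.2.2, hdet, littleMatrix_mulVec_lightlike p.1 p.2⟩

lemma littleGroupOfEuclidean_apply
    (p : (Fin 2 → ℝ) × Matrix.specialOrthogonalGroup (Fin 2) ℝ) (v : Fin 4 → ℝ) :
    (littleGroupOfEuclidean p : (Fin 4 → ℝ) ≃ₗ[ℝ] (Fin 4 → ℝ)) v =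
      (littleMatrix p.1 p.2).mulVec v :=
  rfl

lemma bijective_littleGroupOfEuclidean : Function.Bijective littleGroupOfEuclidean := by
  constructor
  · intro p q h
    have hM : littleMatrix p.1 p.2 = littleMatrix q.1 q.2 := by
      refine Matrix.mulVec_injective (funext fun v => ?_)
      rw [← littleGroupOfEuclidean_apply, h, littleGroupOfEuclidean_apply]
    obtain ⟨h1, h2⟩ := littleMatrix_inj hM
    exact Prod.ext h1 (Subtype.ext h2)
  · rintro ⟨T, hη, hdet, hl⟩
    have hT (v : Fin 4 → ℝ) : (LinearMap.toMatrix' (T : (Fin 4 → ℝ) →ₗ[ℝ] (Fin 4 → ℝ))).mulVec v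
        = T v := LinearMap.toMatrix'_mulVec _ v
    obtain ⟨a, R, hR, hM⟩ := exists_eq_littleMatrix
      (M := LinearMap.toMatrix' (T : (Fin 4 → ℝ) →ₗ[ℝ] (Fin 4 → ℝ)))
      (by simpa only [hT] using hη) (by rwa [LinearMap.det_toMatrix']) (by rwa [hT])
    refine ⟨(a, ⟨R, hR⟩), Subtype.ext (LinearEquiv.ext fun v => ?_)⟩
    rw [littleGroupOfEuclidean_apply, ← hM, hT]

lemma littleGroupOfEuclidean_mul
    (p q : (Fin 2 → ℝ) × Matrix.specialOrthogonalGroup (Fin 2) ℝ) :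
    littleGroupOfEuclidean p * littleGroupOfEuclidean q =
      littleGroupOfEuclidean
        (p.1 + (p.2 : Matrix (Fin 2) (Fin 2) ℝ).mulVec q.1, p.2 * q.2) := by
  refine Subtype.ext (LinearEquiv.ext fun v => ?_)
  rw [Subgroup.coe_mul, LinearEquiv.mul_apply]
  simp only [littleGroupOfEuclidean_apply, Matrix.mulVec_mulVec, Submonoid.coe_mul,
    littleMatrix_mul _ _ p.2.2]

/-- The linear equivalences of `ℝ⁴` preserving the Minkowski form, of
determinant one, and fixing the lightlike vector `ℓ = (1,1,0,0)` form a subgroup of the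
group of linear automorphisms of `ℝ⁴`, and this subgroup is isomorphic as a group to the
Euclidean group `E(2) = ℝ² ⋊ SO(2)` (with product `(a, R)(a', R') = (a + R a', R R')`). -/
theorem little_group_of_lightlike_vector_iso_E2 :
    ∃ H : Subgroup ((Fin 4 → ℝ) ≃ₗ[ℝ] (Fin 4 → ℝ)),
      (∀ T : (Fin 4 → ℝ) ≃ₗ[ℝ] (Fin 4 → ℝ),
        T ∈ H ↔ ((∀ v u : Fin 4 → ℝ, minkowski (T v) (T u) = minkowski v u) ∧
          LinearMap.det (T : (Fin 4 → ℝ) →ₗ[ℝ] (Fin 4 → ℝ)) = 1 ∧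
          T ![1, 1, 0, 0] = ![1, 1, 0, 0])) ∧
      ∃ e : H ≃ ((Fin 2 → ℝ) × Matrix.specialOrthogonalGroup (Fin 2) ℝ),
        ∀ g h : H,
          e (g * h) = ((e g).1 + ((e g).2 : Matrix (Fin 2) (Fin 2) ℝ).mulVec (e h).1,
            (e g).2 * (e h).2) := by
  refine ⟨littleGroup, fun T => Iff.rfl,
    (Equiv.ofBijective _ bijective_littleGroupOfEuclidean).symm, fun g h => ?_⟩
  rw [Equiv.symm_apply_eq, Equiv.ofBijective_apply, ← littleGroupOfEuclidean_mul,
    Equiv.ofBijective_apply_symm_apply littleGroupOfEuclidean,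
    Equiv.ofBijective_apply_symm_apply littleGroupOfEuclidean]
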